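/- arXiv:2407.10138 — 7 statements merged into one kernel-verified Lean document; each statement's English description precedes it below -/
import Mathlib

section
/- Fix an integer k ≥ 1 and let x_1,...,x_k be integers with 0 ≤ x_i ≤ k for every i ∈ [k] and ∑_{i∈[k]} x_i = k. Then ∑_{i∈[k]} x_i · L^k_i = L^k if and only if x_i = 1 for every i ∈ [k]. -/
/-- If nonnegative integer weights grow fast enough that `(n + 1) * w n < w (n + 1)`, then the
all-ones vector is determined, among nonnegative integer vectors with the same coordinate sum,
by its weighted sum. -/
theorem eq_one_of_weighted_sum_eq (k : ℕ) (w : ℕ → ℤ) (hw : ∀ n, 0 ≤ w n)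
    (hgrow : ∀ n < k, ((n : ℤ) + 1) * w n < w (n + 1)) (x : ℕ → ℤ) (m : ℕ) (hm : m ≤ k)
    (hx : ∀ i ∈ Finset.Icc 1 m, 0 ≤ x i) (hsum : ∑ i ∈ Finset.Icc 1 m, x i = (m : ℤ))
    (hwsum : ∑ i ∈ Finset.Icc 1 m, x i * w i = ∑ i ∈ Finset.Icc 1 m, w i) :
    ∀ i ∈ Finset.Icc 1 m, x i = 1 := by
  have hmono : ∀ n ≤ k, ∀ i ≤ n, w i ≤ w n := by
    intro n hn i hi
    induction n, hi using Nat.le_induction with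
    | base => exact le_rfl
    | succ n _ ih =>
      have h := hgrow n hn
      nlinarith [ih (by omega), hw n, mul_nonneg (Int.natCast_nonneg n) (hw n)]
  induction m with
  | zero => simp
  | succ n ih =>
    have hx' : ∀ i ∈ Finset.Icc 1 n, 0 ≤ x i := fun i hi =>
      hx i (Finset.Icc_subset_Icc_right n.le_succ hi)
    have htop : 0 ≤ x (n + 1) := hx _ (by simp)
    rw [Finset.sum_Icc_succ_top (by omega)] at hsum hwsum
    rw [Finset.sum_Icc_succ_top (by omega)] at hwsum
    push_cast at hsum
    have hle : ∀ i ∈ Finset.Icc 1 n, w i ≤ w n := fun i hi =>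
      hmono n (by omega) i (Finset.mem_Icc.1 hi).2
    have hones : ∑ i ∈ Finset.Icc 1 n, w i ≤ n * w n := by
      simpa using Finset.sum_le_card_nsmul _ _ _ hle
    have hones_nonneg : 0 ≤ ∑ i ∈ Finset.Icc 1 n, w i := Finset.sum_nonneg fun i _ => hw i
    have hupper : ∑ i ∈ Finset.Icc 1 n, x i * w i ≤ (∑ i ∈ Finset.Icc 1 n, x i) * w n := by
      rw [Finset.sum_mul]
      exact Finset.sum_le_sum fun i hi => mul_le_mul_of_nonneg_left (hle i hi) (hx' i hi)
    have hlower : 0 ≤ ∑ i ∈ Finset.Icc 1 n, x i * w i :=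
      Finset.sum_nonneg fun i hi => mul_nonneg (hx' i hi) (hw i)
    have hg := hgrow n (by omega)
    have hwn := hw n
    have htop_eq : x (n + 1) = 1 := by
      rcases lt_trichotomy (x (n + 1)) 1 with h | h | h
      · have h0 : x (n + 1) = 0 := by omega
        rw [h0, add_zero] at hsum
        rw [h0, zero_mul, add_zero] at hwsum
        rw [hsum] at hupper
        linarith
      · exact h
      · have h2 : 2 * w (n + 1) ≤ x (n + 1) * w (n + 1) :=
          mul_le_mul_of_nonneg_right h (hw _)
        linarith
    rw [htop_eq] at hsum hwsum
    have hrest := ih (by omega) hx' (by linarith) (by linarith)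
    intro i hi
    rcases (Finset.mem_Icc.1 hi).2.eq_or_lt with rfl | h
    · exact htop_eq
    · exact hrest i (Finset.mem_Icc.2 ⟨(Finset.mem_Icc.1 hi).1, by omega⟩)

/-- The weights `n * k ^ (n - 1)` satisfy the growth condition up to index `k`. -/
theorem succ_mul_weight_lt (k n : ℕ) (hn : n < k) :
    (n + 1) * (n * k ^ (n - 1)) < (n + 1) * k ^ n := by
  refine Nat.mul_lt_mul_of_pos_left ?_ n.succ_pos
  cases n with
  | zero => simp
  | succ n =>
    rw [Nat.add_sub_cancel, pow_succ']
    exact Nat.mul_lt_mul_of_pos_right hn (pow_pos (by omega) n)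

/-- For `k ≥ 1`, `L^k_i = i·k^{i-1}` and `L^k = ∑_{i∈[k]} L^k_i`.  If `x_1,…,x_k` are
integers with `0 ≤ x_i ≤ k` and `∑ x_i = k`, then `∑ x_i·L^k_i = L^k` iff all `x_i = 1`. -/
theorem stmt0 (k : ℕ) (hk : 1 ≤ k) (x : ℕ → ℤ)
    (hx : ∀ i ∈ Finset.Icc 1 k, 0 ≤ x i ∧ x i ≤ (k : ℤ))
    (hsum : ∑ i ∈ Finset.Icc 1 k, x i = (k : ℤ)) :
    (∑ i ∈ Finset.Icc 1 k, x i * ((i * k ^ (i - 1) : ℕ) : ℤ))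
      = ((∑ i ∈ Finset.Icc 1 k, i * k ^ (i - 1) : ℕ) : ℤ)
    ↔ ∀ i ∈ Finset.Icc 1 k, x i = 1 := by
  constructor
  · intro h
    refine eq_one_of_weighted_sum_eq k (fun i => ((i * k ^ (i - 1) : ℕ) : ℤ))
      (fun n => Int.natCast_nonneg _) (fun n hn => ?_) x k le_rfl (fun i hi => (hx i hi).1) hsum ?_
    · exact_mod_cast succ_mul_weight_lt k n hn
    · rw [h, Nat.cast_sum]
  · intro h
    rw [Nat.cast_sum]
    exact Finset.sum_congr rfl fun i hi => by rw [h i hi, one_mul]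
end

section
/- Let Φ be a finite nonempty set, let o_φ ≥ 0 be reals for φ ∈ Φ with o = ∑_{φ∈Φ} o_φ > 0, let 0 < ε < 1, and let t̃ be a real with o/(1+ε) < t̃ ≤ o. Then there exist nonnegative integers (X_φ)_{φ∈Φ} such that: (i) ∑_{φ∈Φ} X_φ ≤ ⌊(1+ε)/ε · |Φ|⌋; (ii) X_φ · (ε·t̃/|Φ|) ≤ o_φ for every φ ∈ Φ; and (iii) ∑_{φ∈Φ} X_φ · (ε·t̃/|Φ|) ≥ (1−ε)·o. -/
open Finset

/-- Coarse guessing of per-path optimum values: given nonnegative reals `o_φ`, `φ ∈ Φ`,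
with positive sum `o`, `0 < ε < 1`, and `o/(1+ε) < t̃ ≤ o`, there are nonnegative
integers `X_φ` with `∑ X_φ ≤ ⌊(1+ε)/ε · |Φ|⌋`, `X_φ·(ε·t̃/|Φ|) ≤ o_φ` for all `φ`, and
`∑ X_φ·(ε·t̃/|Φ|) ≥ (1−ε)·o`. -/
theorem stmt8 {α : Type} (Φ : Finset α) (hΦ : Φ.Nonempty)
    (o : α → ℝ) (ho : ∀ φ ∈ Φ, 0 ≤ o φ) (hsum : 0 < ∑ φ ∈ Φ, o φ)
    (ε : ℝ) (hε : 0 < ε) (hε1 : ε < 1)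
    (t : ℝ) (ht1 : (∑ φ ∈ Φ, o φ) / (1 + ε) < t) (ht2 : t ≤ ∑ φ ∈ Φ, o φ) :
    ∃ X : α → ℕ,
      (∑ φ ∈ Φ, X φ) ≤ ⌊(1 + ε) / ε * (Φ.card : ℝ)⌋₊ ∧
      (∀ φ ∈ Φ, (X φ : ℝ) * (ε * t / (Φ.card : ℝ)) ≤ o φ) ∧
      (1 - ε) * (∑ φ ∈ Φ, o φ) ≤ ∑ φ ∈ Φ, (X φ : ℝ) * (ε * t / (Φ.card : ℝ)) := by
  have hn : (0 : ℝ) < Φ.card := by exact_mod_cast hΦ.card_pos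
  have ht : 0 < t := (div_pos hsum (by linarith)).trans ht1
  set δ : ℝ := ε * t / (Φ.card : ℝ) with hδ_def
  have hδ : 0 < δ := by positivity
  have hcard : (Φ.card : ℝ) * δ = ε * t := mul_div_cancel₀ _ hn.ne'
  have hle : ∀ φ ∈ Φ, (⌊o φ / δ⌋₊ : ℝ) * δ ≤ o φ := fun φ hφ =>
    (le_div_iff₀ hδ).1 (Nat.floor_le (div_nonneg (ho φ hφ) hδ.le))
  refine ⟨fun φ => ⌊o φ / δ⌋₊, Nat.le_floor ?_, hle, ?_⟩
  · have hδ_sum := Finset.sum_le_sum hle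
    rw [← Finset.sum_mul] at hδ_sum
    rw [div_lt_iff₀ (by linarith)] at ht1
    have hbound : (1 + ε) / ε * (Φ.card : ℝ) * δ = t * (1 + ε) := by
      rw [mul_assoc, hcard]
      field_simp
    push_cast
    refine le_of_mul_le_mul_right ?_ hδ
    linarith
  · have hlow : ∑ φ ∈ Φ, (o φ - δ) ≤ ∑ φ ∈ Φ, (⌊o φ / δ⌋₊ : ℝ) * δ := by
      refine Finset.sum_le_sum fun φ _ => ?_
      have hlt := (div_lt_iff₀ hδ).1 (Nat.lt_floor_add_one (o φ / δ))
      linarith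
    rw [Finset.sum_sub_distrib, Finset.sum_const, nsmul_eq_mul, hcard] at hlow
    have := mul_le_mul_of_nonneg_left ht2 hε.le
    linarith
end

section
/- Let T be a finite nonempty set, w : T → ℕ with w_max = max_{i∈T} w(i) > 0, let n = |T|, let 0 < ε < 1, and define p(i) = ⌊n·w(i)/(ε·w_max)⌋ for every i ∈ T. Let 𝓕 be a family of subsets of T containing every singleton {i}, i ∈ T. If S' ∈ 𝓕 satisfies ∑_{i∈S'} p(i) ≥ ∑_{i∈S} p(i) for all S ∈ 𝓕, then ∑_{i∈S'} w(i) ≥ (1−ε) · ∑_{i∈S} w(i) for all S ∈ 𝓕. -/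
open Finset

/-- A maximizer of the sum of the floors of `a * w i` maximizes the sum of `w i` over sets of
cardinality at most `n`, up to an additive error of `n / a`. -/
theorem mul_sum_le_mul_sum_add_of_sum_floor_le {ι : Type*} {S S' : Finset ι} {w : ι → ℕ}
    {a : ℝ} (ha : 0 ≤ a) {n : ℕ} (hS : S.card ≤ n)
    (h : ∑ i ∈ S, ⌊a * (w i : ℝ)⌋₊ ≤ ∑ i ∈ S', ⌊a * (w i : ℝ)⌋₊) :
    a * ∑ i ∈ S, (w i : ℝ) ≤ a * ∑ i ∈ S', (w i : ℝ) + n := by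
  have h_cast : ∑ i ∈ S, (⌊a * (w i : ℝ)⌋₊ : ℝ) ≤ ∑ i ∈ S', (⌊a * (w i : ℝ)⌋₊ : ℝ) := by
    exact_mod_cast h
  have h_card : (S.card : ℝ) ≤ n := by exact_mod_cast hS
  calc a * ∑ i ∈ S, (w i : ℝ)
      = ∑ i ∈ S, a * (w i : ℝ) := Finset.mul_sum ..
    _ ≤ ∑ i ∈ S, ((⌊a * (w i : ℝ)⌋₊ : ℝ) + 1) :=
        Finset.sum_le_sum fun i _ => (Nat.lt_floor_add_one _).le
    _ = ∑ i ∈ S, (⌊a * (w i : ℝ)⌋₊ : ℝ) + S.card := by simp [Finset.sum_add_distrib]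
    _ ≤ ∑ i ∈ S', (⌊a * (w i : ℝ)⌋₊ : ℝ) + n := add_le_add h_cast h_card
    _ ≤ ∑ i ∈ S', a * (w i : ℝ) + n := by
        gcongr with i
        exact Nat.floor_le (by positivity)
    _ = a * ∑ i ∈ S', (w i : ℝ) + n := by rw [Finset.mul_sum]

/-- Standard profit-rounding argument: with `p(i) = ⌊n·w(i)/(ε·w_max)⌋`, any member of
the family `𝓕` (which contains all singletons of `T`) that maximizes the rounded
profit `p` has `w`-weight at least `(1−ε)` times that of every member of `𝓕`. -/
theorem stmt9 {ι : Type} [DecidableEq ι]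
    (T : Finset ι) (hT : T.Nonempty)
    (w : ι → ℕ) (wmax : ℕ)
    (hmax₁ : ∀ i ∈ T, w i ≤ wmax) (hmax₂ : ∃ i ∈ T, w i = wmax) (hpos : 0 < wmax)
    (ε : ℝ) (hε : 0 < ε) (hε1 : ε < 1)
    (F : Finset ι → Prop) (hFsub : ∀ S, F S → S ⊆ T)
    (hsingle : ∀ i ∈ T, F {i})
    (S' : Finset ι) (hS' : F S')
    (hbest : ∀ S, F S →
      ∑ i ∈ S, ⌊(T.card : ℝ) * (w i : ℝ) / (ε * (wmax : ℝ))⌋₊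
        ≤ ∑ i ∈ S', ⌊(T.card : ℝ) * (w i : ℝ) / (ε * (wmax : ℝ))⌋₊) :
    ∀ S, F S → (1 - ε) * ∑ i ∈ S, (w i : ℝ) ≤ ∑ i ∈ S', (w i : ℝ) := by
  have h_card : (0 : ℝ) < T.card := by exact_mod_cast hT.card_pos
  have h_wmax : (0 : ℝ) < wmax := by exact_mod_cast hpos
  have h_additive : ∀ S, F S →
      ∑ i ∈ S, (w i : ℝ) ≤ ∑ i ∈ S', (w i : ℝ) + ε * wmax := by
    intro S hS
    have ha : 0 < (T.card : ℝ) / (ε * wmax) := by positivity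
    have h := hbest S hS
    simp only [mul_div_right_comm] at h
    have h_scaled := mul_sum_le_mul_sum_add_of_sum_floor_le ha.le
      (Finset.card_le_card (hFsub S hS)) h
    refine le_of_mul_le_mul_left ?_ ha
    rwa [mul_add, div_mul_cancel₀ _ (by positivity)]
  intro S hS
  obtain ⟨j, hj, hj_max⟩ := hmax₂
  have h_single := h_additive {j} (hsingle j hj)
  rw [Finset.sum_singleton, hj_max] at h_single
  rcases le_total (wmax : ℝ) (∑ i ∈ S, (w i : ℝ)) with h | h
  · linarith [h_additive S hS, mul_le_mul_of_nonneg_left h hε.le]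
  · linarith [mul_le_mul_of_nonneg_left h (sub_nonneg.2 hε1.le)]
end

section
/- Let k ≥ 1 and n ≥ 1 be integers, let a_1,...,a_n be positive reals, let B be a real, and set scale = 2k·∑_{i∈[n]} a_i. For j ∈ [k] and i ∈ [n] set a^j_i = L^k_j · scale + a_i, and set B' = L^k · scale + B. Then there exist integers x_1,...,x_n with 0 ≤ x_i ≤ k, ∑_{i∈[n]} x_i = k and ∑_{i∈[n]} x_i·a_i = B if and only if there exist r(1),...,r(k) ∈ [n] with ∑_{j∈[k]} a^j_{r(j)} = B'. -/
open Finset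

theorem List.sum_range_getD {α M : Type*} [AddCommMonoid M] (f : α → M) (d : α) (l : List α) :
    ∑ j ∈ Finset.range l.length, f (l.getD j d) = (l.map f).sum := by
  induction l with
  | nil => simp
  | cons b l ih =>
    rw [List.length_cons, Finset.sum_range_succ', List.map_cons, List.sum_cons, ← ih, add_comm]
    simp

theorem Multiset.exists_enumeration {α : Type*} [Inhabited α] (s : Multiset α) :
    ∃ r : ℕ → α, (∀ j ∈ Finset.Icc 1 s.card, r j ∈ s) ∧
      ∀ f : α → ℝ, ∑ j ∈ Finset.Icc 1 s.card, f (r j) = (s.map f).sum := by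
  refine ⟨fun j => s.toList.getD (j - 1) default, fun j hj => ?_, fun f => ?_⟩
  · rw [Finset.mem_Icc] at hj
    have hlt : j - 1 < s.toList.length := by
      rw [Multiset.length_toList]
      omega
    beta_reduce
    rw [List.getD_eq_getElem _ _ hlt, ← Multiset.mem_toList]
    exact List.getElem_mem hlt
  · have h := List.sum_range_getD f default s.toList
    rw [Multiset.length_toList] at h
    rw [← Finset.Ico_add_one_right_eq_Icc, Finset.sum_Ico_eq_sum_range]
    simp only [Nat.add_sub_cancel, Nat.add_sub_cancel_left]
    rw [h, ← Multiset.sum_coe, ← Multiset.map_coe, Multiset.coe_toList]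

/-- Reduction from SSR to SSM: with `scale = 2k·∑ a_i`, `a^j_i = L^k_j·scale + a_i`, and
`B' = L^k·scale + B`, the SSR instance `(a,k,B)` has a solution iff the SSM instance
`(a^j_i, B')` has one. -/
theorem stmt10 (k n : ℕ) (hk : 1 ≤ k) (hn : 1 ≤ n)
    (a : ℕ → ℝ) (ha : ∀ i ∈ Finset.Icc 1 n, 0 < a i) (B : ℝ) :
    (∃ x : ℕ → ℕ, (∀ i ∈ Finset.Icc 1 n, x i ≤ k) ∧
        (∑ i ∈ Finset.Icc 1 n, x i) = k ∧
        (∑ i ∈ Finset.Icc 1 n, (x i : ℝ) * a i) = B) ↔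
    (∃ r : ℕ → ℕ, (∀ j ∈ Finset.Icc 1 k, r j ∈ Finset.Icc 1 n) ∧
        (∑ j ∈ Finset.Icc 1 k,
            (((j * k ^ (j - 1) : ℕ) : ℝ) * (2 * (k : ℝ) * ∑ i ∈ Finset.Icc 1 n, a i)
              + a (r j)))
          = ((∑ i ∈ Finset.Icc 1 k, i * k ^ (i - 1) : ℕ) : ℝ)
              * (2 * (k : ℝ) * ∑ i ∈ Finset.Icc 1 n, a i) + B) := by
  have cancel : ∀ r : ℕ → ℕ,
      (∑ j ∈ Finset.Icc 1 k,
          (((j * k ^ (j - 1) : ℕ) : ℝ) * (2 * (k : ℝ) * ∑ i ∈ Finset.Icc 1 n, a i) + a (r j))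
        = ((∑ i ∈ Finset.Icc 1 k, i * k ^ (i - 1) : ℕ) : ℝ)
            * (2 * (k : ℝ) * ∑ i ∈ Finset.Icc 1 n, a i) + B) ↔
      ∑ j ∈ Finset.Icc 1 k, a (r j) = B := by
    intro r
    rw [Finset.sum_add_distrib, ← Finset.sum_mul, Nat.cast_sum, add_right_inj]
  simp only [cancel]
  constructor
  · rintro ⟨x, -, hcard, hsum⟩
    obtain ⟨r, hr, hf⟩ :=
      (∑ i ∈ Finset.Icc 1 n, Multiset.replicate (x i) i).exists_enumeration
    have hk' : (∑ i ∈ Finset.Icc 1 n, Multiset.replicate (x i) i).card = k := by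
      simpa [Multiset.card_sum] using hcard
    rw [hk'] at hr hf
    refine ⟨r, fun j hj => ?_, ?_⟩
    · obtain ⟨i, hi, hmem⟩ := Multiset.mem_sum.mp (hr j hj)
      rwa [Multiset.eq_of_mem_replicate hmem]
    · rw [hf a, ← hsum, ← Multiset.coe_mapAddMonoidHom, map_sum, ← Multiset.coe_sumAddMonoidHom,
        map_sum]
      simp
  · rintro ⟨r, hr, hsum⟩
    refine ⟨fun i => #{j ∈ Finset.Icc 1 k | r j = i}, fun i _ => ?_, ?_, ?_⟩
    · simpa using Finset.card_filter_le (Finset.Icc 1 k) (fun j => r j = i)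
    · simpa using (Finset.card_eq_sum_card_fiberwise hr).symm
    · rw [← hsum, ← Finset.sum_fiberwise_of_maps_to hr]
      refine Finset.sum_congr rfl fun i _ => ?_
      rw [Finset.sum_congr rfl fun j hj => congrArg a (Finset.mem_filter.mp hj).2]
      simp
end

section
/- Let k ≥ 1 and n ≥ 1 be integers, let a_1,...,a_n be positive reals, let B be a real with 0 < B ≤ k·∑_{i∈[n]} a_i, set scale = 2k·∑_{i∈[n]} a_i, and let w : [n] → [k]. Suppose x_1,...,x_n are nonnegative integers with ∑_{i∈[n]} x_i = k and ∑_{i∈[n]} x_i·(L^k_{w(i)} · scale + a_i) = L^k · scale + B. Then for every t ∈ [k] it holds that ∑_{i∈[n] : w(i)=t} x_i = 1 (in particular x_i ∈ {0,1} for every i), and ∑_{i∈[n]} x_i·a_i = B. -/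
open Finset

/-- A combination of at most `k` of the weights `t * k ^ (t - 1)` with `t ≤ p` is at most
`p * k ^ p`. -/
theorem sum_mul_weight_le (k p : ℕ) (c : ℕ → ℕ) (hc : ∑ t ∈ Finset.Icc 1 p, c t ≤ k) :
    ∑ t ∈ Finset.Icc 1 p, c t * (t * k ^ (t - 1)) ≤ p * k ^ p := by
  rcases Nat.eq_zero_or_pos p with rfl | hp
  · simp
  rcases Nat.eq_zero_or_pos k with rfl | hk
  · have h0 : ∀ t ∈ Finset.Icc 1 p, c t = 0 := Finset.sum_eq_zero_iff.mp (by omega)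
    rw [Finset.sum_eq_zero fun t ht => by rw [h0 t ht, zero_mul]]
    exact Nat.zero_le _
  calc ∑ t ∈ Finset.Icc 1 p, c t * (t * k ^ (t - 1))
      ≤ ∑ t ∈ Finset.Icc 1 p, c t * (p * k ^ (p - 1)) := by
        refine Finset.sum_le_sum fun t ht => ?_
        have htp := (Finset.mem_Icc.mp ht).2
        gcongr
    _ = (∑ t ∈ Finset.Icc 1 p, c t) * (p * k ^ (p - 1)) := (Finset.sum_mul ..).symm
    _ ≤ k * (p * k ^ (p - 1)) := by gcongr
    _ = p * (k ^ (p - 1) * k) := by ring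
    _ = p * k ^ p := by rw [← pow_succ, Nat.sub_add_cancel hp]

/-- The only way to write `∑ t ≤ m, t * k ^ (t - 1)` as a combination of exactly `m ≤ k` of these
weights is to use each of them once. -/
theorem eq_one_of_sum_mul_weight_eq (k : ℕ) (hk : 1 ≤ k) (c : ℕ → ℕ) (m : ℕ) (hm : m ≤ k)
    (hc : ∑ t ∈ Finset.Icc 1 m, c t = m)
    (h : ∑ t ∈ Finset.Icc 1 m, c t * (t * k ^ (t - 1)) = ∑ t ∈ Finset.Icc 1 m, t * k ^ (t - 1)) :
    ∀ t ∈ Finset.Icc 1 m, c t = 1 := by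
  induction m with
  | zero => simp
  | succ p ih =>
    have hpos : 0 < k ^ p := Nat.pow_pos hk
    rw [Finset.sum_Icc_succ_top (by omega)] at hc
    rw [Finset.sum_Icc_succ_top (by omega), Finset.sum_Icc_succ_top (by omega),
      Nat.add_sub_cancel] at h
    have hle := sum_mul_weight_le k p c (by omega)
    have hT := sum_mul_weight_le k p (fun _ => 1) (by simp; omega)
    simp only [one_mul] at hT
    have hone : c (p + 1) = 1 := by
      rcases Nat.lt_trichotomy (c (p + 1)) 1 with h0 | h1 | h2
      · rw [Nat.lt_one_iff.mp h0, zero_mul, add_one_mul] at h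
        omega
      · exact h1
      · have : 2 * ((p + 1) * k ^ p) ≤ c (p + 1) * ((p + 1) * k ^ p) :=
          Nat.mul_le_mul_right _ h2
        rw [add_one_mul] at this h
        omega
    rw [hone] at h hc
    intro t ht
    rcases Nat.lt_or_ge p t with hpt | hpt
    · rwa [show t = p + 1 from le_antisymm (Finset.mem_Icc.mp ht).2 hpt]
    · exact ih (by omega) (by omega) (by omega) t
        (Finset.mem_Icc.mpr ⟨(Finset.mem_Icc.mp ht).1, hpt⟩)

/-- Uniqueness of quotient and remainder for natural quotients and real remainders in `[0, s)`. -/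
theorem eq_and_eq_of_mul_add_eq {p q : ℕ} {s u v : ℝ} (hu : 0 ≤ u) (hus : u < s) (hv : 0 ≤ v)
    (hvs : v < s) (h : (p : ℝ) * s + u = q * s + v) : p = q ∧ u = v := by
  have hpq : p = q := by
    rcases Nat.lt_trichotomy p q with hlt | heq | hlt
    · have : (p : ℝ) + 1 ≤ q := by exact_mod_cast hlt
      nlinarith
    · exact heq
    · have : (q : ℝ) + 1 ≤ p := by exact_mod_cast hlt
      nlinarith
  subst hpq
  exact ⟨rfl, by linarith⟩

/-- Color-coding, converse direction: if nonnegative integers `x_i` with `∑ x_i = k`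
satisfy `∑ x_i·(L^k_{w(i)}·scale + a_i) = L^k·scale + B` (with `0 < B ≤ k·∑ a_i` and
`a_i > 0`), then every color class contributes exactly `1` and `∑ x_i·a_i = B`. -/
theorem stmt12 (k n : ℕ) (hk : 1 ≤ k) (hn : 1 ≤ n)
    (a : ℕ → ℝ) (ha : ∀ i ∈ Finset.Icc 1 n, 0 < a i)
    (B : ℝ) (hB : 0 < B) (hB' : B ≤ (k : ℝ) * ∑ i ∈ Finset.Icc 1 n, a i)
    (w : ℕ → ℕ) (hw : ∀ i ∈ Finset.Icc 1 n, w i ∈ Finset.Icc 1 k)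
    (x : ℕ → ℕ)
    (hxsum : (∑ i ∈ Finset.Icc 1 n, x i) = k)
    (hxa : (∑ i ∈ Finset.Icc 1 n, (x i : ℝ) *
        (((w i * k ^ (w i - 1) : ℕ) : ℝ) * (2 * (k : ℝ) * ∑ i ∈ Finset.Icc 1 n, a i)
          + a i))
      = ((∑ i ∈ Finset.Icc 1 k, i * k ^ (i - 1) : ℕ) : ℝ)
          * (2 * (k : ℝ) * ∑ i ∈ Finset.Icc 1 n, a i) + B) :
    (∀ t ∈ Finset.Icc 1 k,
        ∑ i ∈ (Finset.Icc 1 n).filter (fun i => w i = t), x i = 1) ∧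
    (∑ i ∈ Finset.Icc 1 n, (x i : ℝ) * a i) = B := by
  have hS : 0 < ∑ i ∈ Finset.Icc 1 n, a i :=
    Finset.sum_pos ha ⟨1, Finset.mem_Icc.mpr ⟨le_rfl, hn⟩⟩
  have hk' : (0 : ℝ) < k := by exact_mod_cast hk
  have hkS := mul_pos hk' hS
  have hxk : ∑ i ∈ Finset.Icc 1 n, (x i : ℝ) * a i ≤ k * ∑ i ∈ Finset.Icc 1 n, a i := by
    rw [Finset.mul_sum]
    refine Finset.sum_le_sum fun i hi => mul_le_mul_of_nonneg_right ?_ (ha i hi).le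
    exact_mod_cast hxsum ▸ Finset.single_le_sum (fun j _ => Nat.zero_le (x j)) hi
  have hx0 : 0 ≤ ∑ i ∈ Finset.Icc 1 n, (x i : ℝ) * a i :=
    Finset.sum_nonneg fun i hi => mul_nonneg (Nat.cast_nonneg _) (ha i hi).le
  have hsplit : ((∑ i ∈ Finset.Icc 1 n, x i * (w i * k ^ (w i - 1)) : ℕ) : ℝ)
        * (2 * (k : ℝ) * ∑ i ∈ Finset.Icc 1 n, a i) + ∑ i ∈ Finset.Icc 1 n, (x i : ℝ) * a i
      = ((∑ i ∈ Finset.Icc 1 k, i * k ^ (i - 1) : ℕ) : ℝ)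
        * (2 * (k : ℝ) * ∑ i ∈ Finset.Icc 1 n, a i) + B := by
    rw [← hxa, Nat.cast_sum, Finset.sum_mul, ← Finset.sum_add_distrib]
    refine Finset.sum_congr rfl fun i _ => ?_
    rw [Nat.cast_mul (x i)]
    ring
  obtain ⟨hL, hxB⟩ :=
    eq_and_eq_of_mul_add_eq hx0 (by linarith) hB.le (by linarith) hsplit
  refine ⟨?_, hxB⟩
  apply eq_one_of_sum_mul_weight_eq k hk
    (fun t => ∑ i ∈ (Finset.Icc 1 n).filter (fun i => w i = t), x i) k le_rfl
  · rw [Finset.sum_fiberwise_of_maps_to hw, hxsum]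
  · rw [← hL, ← Finset.sum_fiberwise_of_maps_to hw]
    refine Finset.sum_congr rfl fun t _ => ?_
    rw [Finset.sum_mul]
    refine Finset.sum_congr rfl fun i hi => ?_
    rw [(Finset.mem_filter.mp hi).2]
end

section
/- Fix an integer x with k ≤ x ≤ k·n and let F be a feasible solution of U_x with profit w(F) ≥ 3k·H + k·(k+1)·L + k·(k+1)·x. Let F_z = {(i,j) : z^i_j ∈ F}, F_q = {(i,j) : q^i_j ∈ F} and F_δ = {i : δ_i ∈ F}. Then |F_z| = |F_q| = |F_δ| = k. -/
open Finset

noncomputable section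

/-! Definitions of the UFP instance `U_x` built from an SSM instance with numbers
`a i j` (`i ∈ [k]`, `j ∈ [n]`) and target `B`.  Tasks `z^i_j` and `q^i_j` are encoded
by the pair `(i,j)` in the finsets `Fz` and `Fq` respectively, and tasks `δ_i` by the
index `i` in the finset `Fd`.  Edges are `e_h` for `h ∈ {0,…,k}` and `f_t` for
`t ∈ [k]`: task `z^i_j` uses `e_h` for `h < i` and `f_t` for `t < i`; task `q^i_j`
uses `e_h` for `i ≤ h` and `f_t` for `i < t`; task `δ_i` uses only `f_i`. -/

/-- `ρ = 2B + ∑_{i∈[k]}∑_{j∈[n]} a i j`. -/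
def rhoC (n k : ℕ) (a : ℕ → ℕ → ℝ) (B : ℝ) : ℝ :=
  2 * B + ∑ i ∈ Finset.Icc 1 k, ∑ j ∈ Finset.Icc 1 n, a i j

/-- `W = 1 + ρ`. -/
def Wc (n k : ℕ) (a : ℕ → ℕ → ℝ) (B : ℝ) : ℝ := 1 + rhoC n k a B

/-- `Q = 1 + (kn+1)·W`. -/
def Qc (n k : ℕ) (a : ℕ → ℕ → ℝ) (B : ℝ) : ℝ :=
  1 + ((k * n + 1 : ℕ) : ℝ) * Wc n k a B

/-- `L = 2(kn)² + 1`. -/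
def Lc (n k : ℕ) : ℝ := 2 * ((k * n : ℕ) : ℝ) ^ 2 + 1

/-- `H = 2k²L + 2k²n + 1`. -/
def Hc (n k : ℕ) : ℝ := 2 * (k : ℝ) ^ 2 * Lc n k + 2 * (k : ℝ) ^ 2 * (n : ℝ) + 1

/-- Demand of the task `z^i_j`: `Q + j·W + a i j`. -/
def dz (n k : ℕ) (a : ℕ → ℕ → ℝ) (B : ℝ) (i j : ℕ) : ℝ :=
  Qc n k a B + (j : ℝ) * Wc n k a B + a i j

/-- Demand of the task `q^i_j`: `Q + j·W + 2B/k − a i j`. -/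
def dq (n k : ℕ) (a : ℕ → ℕ → ℝ) (B : ℝ) (i j : ℕ) : ℝ :=
  Qc n k a B + (j : ℝ) * Wc n k a B + 2 * B / (k : ℝ) - a i j

/-- Feasibility of the solution `(Fz, Fq, Fd)` of `U_x`: tasks have valid indices and
every edge capacity is respected.  The capacity of `e_0` and `e_k` is `kQ + xW + B`,
and every other edge has capacity `kQ + xW + ρ`. -/
def UxFeasible (n k x : ℕ) (a : ℕ → ℕ → ℝ) (B : ℝ)
    (Fz Fq : Finset (ℕ × ℕ)) (Fd : Finset ℕ) : Prop :=
  Fz ⊆ Finset.Icc 1 k ×ˢ Finset.Icc 1 n ∧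
  Fq ⊆ Finset.Icc 1 k ×ˢ Finset.Icc 1 n ∧
  Fd ⊆ Finset.Icc 1 k ∧
  (∀ h ∈ Finset.Icc 0 k,
    (∑ q ∈ Fz.filter (fun q => h < q.1), dz n k a B q.1 q.2) +
    (∑ q ∈ Fq.filter (fun q => q.1 ≤ h), dq n k a B q.1 q.2)
      ≤ (k : ℝ) * Qc n k a B + (x : ℝ) * Wc n k a B +
          (if h = 0 ∨ h = k then B else rhoC n k a B)) ∧
  (∀ t ∈ Finset.Icc 1 k,
    (∑ q ∈ Fz.filter (fun q => t < q.1), dz n k a B q.1 q.2) +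
    (∑ q ∈ Fq.filter (fun q => q.1 < t), dq n k a B q.1 q.2) +
    (if t ∈ Fd then Qc n k a B else 0)
      ≤ (k : ℝ) * Qc n k a B + (x : ℝ) * Wc n k a B + rhoC n k a B)

/-- Total profit of the solution `(Fz, Fq, Fd)`:
`w(z^i_j) = H + iL + ji`, `w(q^i_j) = H + (k+1−i)L + (k+1−i)j`, `w(δ_i) = H`. -/
def UxProfit (n k : ℕ) (Fz Fq : Finset (ℕ × ℕ)) (Fd : Finset ℕ) : ℝ :=
  (∑ q ∈ Fz, (Hc n k + (q.1 : ℝ) * Lc n k + (q.2 : ℝ) * (q.1 : ℝ))) +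
  (∑ q ∈ Fq, (Hc n k + ((k : ℝ) + 1 - (q.1 : ℝ)) * Lc n k
      + ((k : ℝ) + 1 - (q.1 : ℝ)) * (q.2 : ℝ))) +
  (Fd.card : ℝ) * Hc n k

end

theorem rhoC_nonneg {n k : ℕ} {a : ℕ → ℕ → ℝ} {B : ℝ} (hB : 0 < B)
    (ha : ∀ i ∈ Finset.Icc 1 k, ∀ j ∈ Finset.Icc 1 n, 0 < a i j ∧ a i j < 2 * B / (k : ℝ)) :
    0 ≤ rhoC n k a B := by
  have h : 0 ≤ ∑ i ∈ Finset.Icc 1 k, ∑ j ∈ Finset.Icc 1 n, a i j :=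
    Finset.sum_nonneg fun i hi => Finset.sum_nonneg fun j hj => (ha i hi j hj).1.le
  unfold rhoC
  linarith

/-- A set of tasks with demands at least `Q` that fits into the capacity `kQ + xW + B`
has at most `k` elements. -/
theorem card_le_of_sum_demand_le {n k x : ℕ} {a : ℕ → ℕ → ℝ} {B : ℝ} (hB1 : 2 * B < 1)
    (hrho : 0 ≤ rhoC n k a B) (hx : x ≤ k * n) (F : Finset (ℕ × ℕ)) (d : ℕ × ℕ → ℝ)
    (hd : ∀ q ∈ F, Qc n k a B ≤ d q)
    (hF : ∑ q ∈ F, d q ≤ (k : ℝ) * Qc n k a B + (x : ℝ) * Wc n k a B + B) :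
    F.card ≤ k := by
  have hW : 1 ≤ Wc n k a B := by unfold Wc; linarith
  have hxW : (x : ℝ) * Wc n k a B ≤ ((k * n : ℕ) : ℝ) * Wc n k a B :=
    mul_le_mul_of_nonneg_right (by exact_mod_cast hx) (by linarith)
  have hQ : Qc n k a B = 1 + ((k * n : ℕ) : ℝ) * Wc n k a B + Wc n k a B := by
    unfold Qc; push_cast; ring
  have hQ0 : 0 < Qc n k a B := by
    have : 0 ≤ ((k * n : ℕ) : ℝ) * Wc n k a B := mul_nonneg (Nat.cast_nonneg _) (by linarith)
    linarith
  have hcard : (F.card : ℝ) * Qc n k a B ≤ ∑ q ∈ F, d q := by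
    simpa using Finset.card_nsmul_le_sum F d _ hd
  have hlt : (F.card : ℝ) * Qc n k a B < ((k + 1 : ℕ) : ℝ) * Qc n k a B := by
    push_cast; linarith
  exact Nat.lt_succ_iff.mp (by exact_mod_cast lt_of_mul_lt_mul_right hlt hQ0.le)

/-- A task family with profits `H + c L + c j`, where `c ≤ k` and `j ≤ n`, earns at most
`H + kL + kn` per task. -/
theorem sum_profit_le {n k : ℕ} (F : Finset (ℕ × ℕ)) (c : ℕ × ℕ → ℝ)
    (hc : ∀ q ∈ F, c q ≤ k) (hj : ∀ q ∈ F, q.2 ≤ n) :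
    ∑ q ∈ F, (Hc n k + c q * Lc n k + c q * (q.2 : ℝ)) ≤
      (F.card : ℝ) * (Hc n k + k * Lc n k + k * n) := by
  have hL : 0 ≤ Lc n k := by unfold Lc; positivity
  rw [← nsmul_eq_mul]
  refine Finset.sum_le_card_nsmul F _ _ fun q hq => ?_
  have h1 : c q * Lc n k ≤ k * Lc n k := mul_le_mul_of_nonneg_right (hc q hq) hL
  have h2 : c q * (q.2 : ℝ) ≤ k * n :=
    mul_le_mul (hc q hq) (by exact_mod_cast hj q hq) (by positivity) (by positivity)
  linarith

/-- A feasible solution of `U_x` of profit at least `3kH + k(k+1)L + k(k+1)x` contains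
exactly `k` tasks of each of the three types `z`, `q`, `δ`. -/
theorem stmt16 (n k : ℕ) (hn : 1 ≤ n) (hk : 1 ≤ k)
    (a : ℕ → ℕ → ℝ) (B : ℝ) (hB : 0 < B) (hB1 : 2 * B < 1)
    (ha : ∀ i ∈ Finset.Icc 1 k, ∀ j ∈ Finset.Icc 1 n,
      0 < a i j ∧ a i j < 2 * B / (k : ℝ))
    (hrho : rhoC n k a B < 1)
    (x : ℕ) (hx1 : k ≤ x) (hx2 : x ≤ k * n)
    (Fz Fq : Finset (ℕ × ℕ)) (Fd : Finset ℕ)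
    (hfeas : UxFeasible n k x a B Fz Fq Fd)
    (hprofit : 3 * (k : ℝ) * Hc n k + (k : ℝ) * ((k : ℝ) + 1) * Lc n k
            + (k : ℝ) * ((k : ℝ) + 1) * (x : ℝ)
          ≤ UxProfit n k Fz Fq Fd) :
    Fz.card = k ∧ Fq.card = k ∧ Fd.card = k := by
  obtain ⟨hz, hq, hd, he, -⟩ := hfeas
  have hr := rhoC_nonneg hB ha
  have hW : 0 ≤ Wc n k a B := by unfold Wc; linarith
  have hzI : ∀ p ∈ Fz, (1 ≤ p.1 ∧ p.1 ≤ k) ∧ 1 ≤ p.2 ∧ p.2 ≤ n := fun p hp => by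
    simpa using hz hp
  have hqI : ∀ p ∈ Fq, (1 ≤ p.1 ∧ p.1 ≤ k) ∧ 1 ≤ p.2 ∧ p.2 ≤ n := fun p hp => by
    simpa using hq hp
  have hdz : ∀ p ∈ Fz, Qc n k a B ≤ dz n k a B p.1 p.2 := fun p hp => by
    have h := ha p.1 (Finset.mem_Icc.2 (hzI p hp).1) p.2 (Finset.mem_Icc.2 (hzI p hp).2)
    have : 0 ≤ (p.2 : ℝ) * Wc n k a B := mul_nonneg (Nat.cast_nonneg _) hW
    unfold dz
    linarith
  have hdq : ∀ p ∈ Fq, Qc n k a B ≤ dq n k a B p.1 p.2 := fun p hp => by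
    have h := ha p.1 (Finset.mem_Icc.2 (hqI p hp).1) p.2 (Finset.mem_Icc.2 (hqI p hp).2)
    have : 0 ≤ (p.2 : ℝ) * Wc n k a B := mul_nonneg (Nat.cast_nonneg _) hW
    unfold dq
    linarith
  have hzk : Fz.card ≤ k := by
    have h := he 0 (by simp)
    rw [Finset.filter_true_of_mem (s := Fz) (p := fun p => 0 < p.1) fun p hp => (hzI p hp).1.1,
      Finset.filter_false_of_mem (s := Fq) fun p hp => by have := (hqI p hp).1.1; omega] at h
    exact card_le_of_sum_demand_le hB1 hr hx2 Fz _ hdz (by simpa using h)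
  have hqk : Fq.card ≤ k := by
    have h := he k (by simp)
    rw [Finset.filter_true_of_mem (s := Fq) fun p hp => (hqI p hp).1.2,
      Finset.filter_false_of_mem (s := Fz) fun p hp => by have := (hzI p hp).1.2; omega] at h
    exact card_le_of_sum_demand_le hB1 hr hx2 Fq _ hdq (by simpa using h)
  have hdk : Fd.card ≤ k := by simpa using Finset.card_le_card hd
  have hpz := sum_profit_le (n := n) (k := k) Fz (fun p => (p.1 : ℝ))
    (fun p hp => by exact_mod_cast (hzI p hp).1.2) (fun p hp => (hzI p hp).2.2)
  have hpq := sum_profit_le (n := n) (k := k) Fq (fun p => (k : ℝ) + 1 - (p.1 : ℝ))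
    (fun p hp => by
      have : (1 : ℝ) ≤ p.1 := by exact_mod_cast (hqI p hp).1.1
      linarith) (fun p hp => (hqI p hp).2.2)
  have hL : 0 ≤ Lc n k := by unfold Lc; positivity
  have hH : 0 ≤ Hc n k := by unfold Hc; positivity
  have hHdef : Hc n k = 2 * (k : ℝ) * (k * Lc n k + k * n) + 1 := by unfold Hc; ring
  suffices 3 * k ≤ Fz.card + Fq.card + Fd.card by omega
  by_contra! hlt
  have hcount : (Fz.card : ℝ) + Fq.card + Fd.card + 1 ≤ 3 * k := by exact_mod_cast hlt
  have hcountH := mul_le_mul_of_nonneg_right hcount hH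
  have hzq : ((Fz.card : ℝ) + Fq.card) * (k * Lc n k + k * n) ≤
      2 * k * (k * Lc n k + k * n) := by
    refine mul_le_mul_of_nonneg_right ?_ (by positivity)
    exact_mod_cast (by omega : Fz.card + Fq.card ≤ 2 * k)
  have hextra : 0 ≤ (k : ℝ) * ((k : ℝ) + 1) * Lc n k + (k : ℝ) * ((k : ℝ) + 1) * (x : ℝ) := by
    positivity
  have hcomm : ∑ q ∈ Fz, (Hc n k + (q.1 : ℝ) * Lc n k + (q.2 : ℝ) * (q.1 : ℝ)) =
      ∑ q ∈ Fz, (Hc n k + (q.1 : ℝ) * Lc n k + (q.1 : ℝ) * (q.2 : ℝ)) :=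
    Finset.sum_congr rfl fun q _ => by ring
  unfold UxProfit at hprofit
  rw [hcomm] at hprofit
  linarith
end

section
/- Fix an integer x with k ≤ x ≤ k·n and let F be a feasible solution of U_x with profit w(F) ≥ 3k·H + k·(k+1)·L + k·(k+1)·x. For i ∈ [k] let F^i_z = {j ∈ [n] : z^i_j ∈ F} and F^i_q = {j ∈ [n] : q^i_j ∈ F}. Then |F^i_z| = |F^i_q| = 1 for every i ∈ [k]. -/
open Finset

/-- A packing bound: if items of size at least `Q` fit into capacity `k * Q + r` with `r < Q`,
then there are at most `k` of them. -/
lemma natCast_mul_le_capacity {m k : ℕ} {Q r : ℝ} (hr : r < Q) (hQ : 0 < Q)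
    (h : (m : ℝ) * Q ≤ k * Q + r) : m ≤ k := by
  have h' : (m : ℝ) < k + 1 := lt_of_mul_lt_mul_right (by linarith) hQ.le
  exact Nat.lt_succ_iff.mp (by exact_mod_cast h')

lemma sum_card_filter_lt {F : Finset (ℕ × ℕ)} {k : ℕ} (hF : ∀ q ∈ F, q.1 ≤ k) :
    ∑ h ∈ range (k + 1), #{q ∈ F | h < q.1} = ∑ q ∈ F, q.1 := by
  simp only [card_filter]
  rw [sum_comm]
  refine sum_congr rfl fun q hq => ?_
  have hfilter : {h ∈ range (k + 1) | h < q.1} = range q.1 := by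
    ext h
    have := hF q hq
    simp only [mem_filter, mem_range]
    omega
  rw [← card_filter, hfilter, card_range]

lemma sum_card_filter_le {F : Finset (ℕ × ℕ)} {k : ℕ} :
    ∑ h ∈ range (k + 1), #{q ∈ F | q.1 ≤ h} = ∑ q ∈ F, (k + 1 - q.1) := by
  simp only [card_filter]
  rw [sum_comm]
  refine sum_congr rfl fun q _ => ?_
  have hfilter : {h ∈ range (k + 1) | q.1 ≤ h} = Ico q.1 (k + 1) := by
    ext h
    simp only [mem_filter, mem_range, mem_Ico]
    omega
  rw [← card_filter, hfilter, Nat.card_Ico]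

/-- If `k` pairs have first coordinates in `[k]` and every value in `[k]` occurs,
then each value occurs exactly once. -/
lemma card_fiber_eq_one {F : Finset (ℕ × ℕ)} {k : ℕ} (hF : ∀ q ∈ F, q.1 ∈ Icc 1 k)
    (hcard : #F = k) (hpos : ∀ i ∈ Icc 1 k, 1 ≤ #{q ∈ F | q.1 = i}) :
    ∀ i ∈ Icc 1 k, #{q ∈ F | q.1 = i} = 1 := by
  have hsum := card_eq_sum_card_fiberwise (f := Prod.fst) (s := F) (t := Icc 1 k) hF
  have heq : ∑ i ∈ Icc 1 k, 1 = ∑ i ∈ Icc 1 k, #{q ∈ F | q.1 = i} := by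
    rw [← hsum, hcard]
    simp
  exact fun i hi => ((sum_eq_sum_iff_of_le hpos).mp heq i hi).symm

lemma rhoC_pos {n k : ℕ} {a : ℕ → ℕ → ℝ} {B : ℝ} (hB : 0 < B)
    (ha : ∀ i ∈ Icc 1 k, ∀ j ∈ Icc 1 n, 0 < a i j) : 0 < rhoC n k a B := by
  have : 0 ≤ ∑ i ∈ Icc 1 k, ∑ j ∈ Icc 1 n, a i j :=
    sum_nonneg fun i hi => sum_nonneg fun j hj => (ha i hi j hj).le
  unfold rhoC
  linarith

lemma capacity_slack_lt_Qc {n k x : ℕ} {a : ℕ → ℕ → ℝ} {B : ℝ} (hW : 0 < Wc n k a B)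
    (hx : x ≤ k * n) : (x : ℝ) * Wc n k a B + rhoC n k a B < Qc n k a B := by
  have hx' : (x : ℝ) * Wc n k a B ≤ ((k * n : ℕ) : ℝ) * Wc n k a B := by gcongr
  have hρ : rhoC n k a B = Wc n k a B - 1 := by unfold Wc; ring
  unfold Qc
  rw [hρ, Nat.cast_succ]
  linarith

section Counting

variable {n k x : ℕ} {a : ℕ → ℕ → ℝ} {B : ℝ} {Fz Fq : Finset (ℕ × ℕ)} {Fd : Finset ℕ}

lemma Qc_le_dz {i j : ℕ} (hW : 0 ≤ Wc n k a B) (ha : 0 ≤ a i j) :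
    Qc n k a B ≤ dz n k a B i j := by
  have := mul_nonneg j.cast_nonneg (α := ℝ) hW
  unfold dz
  linarith

lemma Qc_le_dq {i j : ℕ} (hW : 0 ≤ Wc n k a B) (ha : a i j ≤ 2 * B / k) :
    Qc n k a B ≤ dq n k a B i j := by
  have := mul_nonneg j.cast_nonneg (α := ℝ) hW
  unfold dq
  linarith

/-- In a feasible solution, at most `k` tasks use any given edge. -/
lemma UxFeasible.card_le (hB : 0 < B)
    (ha : ∀ i ∈ Icc 1 k, ∀ j ∈ Icc 1 n, 0 < a i j ∧ a i j < 2 * B / (k : ℝ))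
    (hx : x ≤ k * n) (hfeas : UxFeasible n k x a B Fz Fq Fd) :
    (∀ h ∈ range (k + 1), #{q ∈ Fz | h < q.1} + #{q ∈ Fq | q.1 ≤ h} ≤ k) ∧
    ∀ t ∈ Icc 1 k, #{q ∈ Fz | t < q.1} + #{q ∈ Fq | q.1 < t} + (if t ∈ Fd then 1 else 0) ≤ k := by
  obtain ⟨hFz, hFq, -, he, hf⟩ := hfeas
  have hρ : 0 < rhoC n k a B := rhoC_pos hB fun i hi j hj => (ha i hi j hj).1
  have hBρ : B ≤ rhoC n k a B := by
    have : 0 ≤ ∑ i ∈ Icc 1 k, ∑ j ∈ Icc 1 n, a i j :=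
      sum_nonneg fun i hi => sum_nonneg fun j hj => (ha i hi j hj).1.le
    unfold rhoC
    linarith
  have hW : 0 < Wc n k a B := by unfold Wc; linarith
  have hslack := capacity_slack_lt_Qc hW hx
  have hQ : 0 < Qc n k a B := by
    have := mul_nonneg x.cast_nonneg (α := ℝ) hW.le
    linarith
  have hz (p : ℕ × ℕ → Prop) [DecidablePred p] :
      (#{q ∈ Fz | p q} : ℝ) * Qc n k a B ≤ ∑ q ∈ Fz with p q, dz n k a B q.1 q.2 := by
    rw [← nsmul_eq_mul]
    refine card_nsmul_le_sum _ _ _ fun q hq => ?_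
    obtain ⟨h1, h2⟩ := mem_product.mp (hFz (mem_filter.mp hq).1)
    exact Qc_le_dz hW.le (ha _ h1 _ h2).1.le
  have hq (p : ℕ × ℕ → Prop) [DecidablePred p] :
      (#{q ∈ Fq | p q} : ℝ) * Qc n k a B ≤ ∑ q ∈ Fq with p q, dq n k a B q.1 q.2 := by
    rw [← nsmul_eq_mul]
    refine card_nsmul_le_sum _ _ _ fun q hq => ?_
    obtain ⟨h1, h2⟩ := mem_product.mp (hFq (mem_filter.mp hq).1)
    exact Qc_le_dq hW.le (ha _ h1 _ h2).2.le
  constructor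
  · intro h hh
    have hcap := he h (mem_Icc.mpr ⟨h.zero_le, Nat.lt_succ_iff.mp (mem_range.mp hh)⟩)
    have hite : (if h = 0 ∨ h = k then B else rhoC n k a B) ≤ rhoC n k a B := by
      split_ifs
      exacts [hBρ, le_rfl]
    refine natCast_mul_le_capacity hslack hQ ?_
    push_cast
    linarith [hz fun q => h < q.1, hq fun q => q.1 ≤ h]
  · intro t ht
    have hcap := hf t ht
    have hite : (((if t ∈ Fd then 1 else 0 : ℕ)) : ℝ) * Qc n k a B
        = if t ∈ Fd then Qc n k a B else 0 := by
      split_ifs <;> simp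
    refine natCast_mul_le_capacity hslack hQ ?_
    rw [Nat.cast_add, Nat.cast_add, add_mul, add_mul, hite]
    linarith [hz fun q => t < q.1, hq fun q => q.1 < t]

/-- The profit is bounded in terms of the number of tasks and of the total number
of pairs (task, edge `e_h` used by the task). -/
lemma UxProfit_le (hFz : Fz ⊆ Icc 1 k ×ˢ Icc 1 n) (hFq : Fq ⊆ Icc 1 k ×ˢ Icc 1 n) :
    UxProfit n k Fz Fq Fd ≤ ((#Fz + #Fq + #Fd : ℕ) : ℝ) * Hc n k + (Lc n k + n) *
      ((∑ h ∈ range (k + 1), (#{q ∈ Fz | h < q.1} + #{q ∈ Fq | q.1 ≤ h}) : ℕ) : ℝ) := by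
  have hFz' : ∀ q ∈ Fz, q.1 ≤ k := fun q hq => (mem_Icc.mp (mem_product.mp (hFz hq)).1).2
  rw [sum_add_distrib, sum_card_filter_lt hFz', sum_card_filter_le]
  have hz : ∑ q ∈ Fz, (Hc n k + (q.1 : ℝ) * Lc n k + (q.2 : ℝ) * (q.1 : ℝ))
      ≤ #Fz * Hc n k + (Lc n k + n) * ∑ q ∈ Fz, (q.1 : ℝ) := by
    rw [← nsmul_eq_mul, ← sum_const, mul_sum, ← sum_add_distrib]
    refine sum_le_sum fun q hq => ?_
    have hj : (q.2 : ℝ) ≤ n := by exact_mod_cast (mem_Icc.mp (mem_product.mp (hFz hq)).2).2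
    have := mul_le_mul_of_nonneg_right hj (q.1.cast_nonneg (α := ℝ))
    linarith
  have hq : ∑ q ∈ Fq, (Hc n k + ((k : ℝ) + 1 - (q.1 : ℝ)) * Lc n k
      + ((k : ℝ) + 1 - (q.1 : ℝ)) * (q.2 : ℝ))
      ≤ #Fq * Hc n k + (Lc n k + n) * ∑ q ∈ Fq, ((k + 1 - q.1 : ℕ) : ℝ) := by
    rw [← nsmul_eq_mul, ← sum_const, mul_sum, ← sum_add_distrib]
    refine sum_le_sum fun q hq => ?_
    have hq' := mem_product.mp (hFq hq)
    have hj : (q.2 : ℝ) ≤ n := by exact_mod_cast (mem_Icc.mp hq'.2).2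
    have hi : q.1 ≤ k + 1 := (mem_Icc.mp hq'.1).2.trans k.le_succ
    have := mul_le_mul_of_nonneg_right hj ((k + 1 - q.1).cast_nonneg (α := ℝ))
    rw [Nat.cast_sub hi] at this ⊢
    push_cast at this ⊢
    linarith
  unfold UxProfit
  push_cast
  linarith

end Counting

/-- In a feasible solution of `U_x` of profit at least `3kH + k(k+1)L + k(k+1)x`, for
every `i ∈ [k]` exactly one task `z^i_j` and exactly one task `q^i_j` is selected. -/
theorem stmt18 (n k : ℕ) (hn : 1 ≤ n) (hk : 1 ≤ k)
    (a : ℕ → ℕ → ℝ) (B : ℝ) (hB : 0 < B) (hB1 : 2 * B < 1)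
    (ha : ∀ i ∈ Finset.Icc 1 k, ∀ j ∈ Finset.Icc 1 n,
      0 < a i j ∧ a i j < 2 * B / (k : ℝ))
    (hrho : rhoC n k a B < 1)
    (x : ℕ) (hx1 : k ≤ x) (hx2 : x ≤ k * n)
    (Fz Fq : Finset (ℕ × ℕ)) (Fd : Finset ℕ)
    (hfeas : UxFeasible n k x a B Fz Fq Fd)
    (hprofit : 3 * (k : ℝ) * Hc n k + (k : ℝ) * ((k : ℝ) + 1) * Lc n k
            + (k : ℝ) * ((k : ℝ) + 1) * (x : ℝ)
          ≤ UxProfit n k Fz Fq Fd) :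
    ∀ i ∈ Finset.Icc 1 k,
      (Fz.filter (fun q => q.1 = i)).card = 1 ∧
      (Fq.filter (fun q => q.1 = i)).card = 1 := by
  obtain ⟨hedge_e, hedge_f⟩ := hfeas.card_le hB ha hx2
  obtain ⟨hFz, hFq, hFd, -, -⟩ := hfeas
  have hprofit' := hprofit.trans (UxProfit_le hFz hFq)
  have hFz' : ∀ q ∈ Fz, q.1 ∈ Icc 1 k := fun q hq => (mem_product.mp (hFz hq)).1
  have hFq' : ∀ q ∈ Fq, q.1 ∈ Icc 1 k := fun q hq => (mem_product.mp (hFq hq)).1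
  have hcz : #Fz ≤ k := by
    have h0 : {q ∈ Fz | 0 < q.1} = Fz :=
      filter_true_of_mem fun q hq => (mem_Icc.mp (hFz' q hq)).1
    have := hedge_e 0 (by simp)
    rw [h0] at this
    omega
  have hcq : #Fq ≤ k := by
    have hk' : {q ∈ Fq | q.1 ≤ k} = Fq :=
      filter_true_of_mem fun q hq => (mem_Icc.mp (hFq' q hq)).2
    have := hedge_e k (by simp)
    rw [hk'] at this
    omega
  have hcd : #Fd ≤ k := by simpa using card_le_card hFd
  set S := ∑ h ∈ range (k + 1), (#{q ∈ Fz | h < q.1} + #{q ∈ Fq | q.1 ≤ h})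
  have hSconst : ∑ h ∈ range (k + 1), k = k * (k + 1) := by simp [mul_comm]
  have hSle : S ≤ k * (k + 1) := hSconst ▸ sum_le_sum hedge_e
  have hn' : (1 : ℝ) ≤ n := by exact_mod_cast hn
  have hk' : (1 : ℝ) ≤ k := by exact_mod_cast hk
  have hL : (n : ℝ) * (k * (k + 1)) < Lc n k := by
    have hkk : (k : ℝ) * (k + 1) ≤ 2 * (k : ℝ) ^ 2 := by nlinarith
    have hnn : (n : ℝ) ≤ (n : ℝ) ^ 2 := by nlinarith
    have := mul_le_mul hnn hkk (by positivity) (by positivity)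
    unfold Lc
    push_cast
    linarith
  have hL0 : 0 < Lc n k := by unfold Lc; positivity
  have hH : (n : ℝ) * (k * (k + 1)) < Hc n k := by
    have : Lc n k ≤ 2 * (k : ℝ) ^ 2 * Lc n k :=
      le_mul_of_one_le_left hL0.le (by nlinarith)
    have : 0 ≤ 2 * (k : ℝ) ^ 2 * (n : ℝ) := by positivity
    unfold Hc
    linarith
  have hH0 : 0 < Hc n k := lt_of_le_of_lt (by positivity) hH
  have hx0 : 0 ≤ (k : ℝ) * ((k : ℝ) + 1) * (x : ℝ) := by positivity
  have hSle' : (Lc n k + n) * (S : ℝ) ≤ (Lc n k + n) * (k * (k + 1)) := by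
    have : (S : ℝ) ≤ k * (k + 1) := by exact_mod_cast hSle
    gcongr
  have hN : #Fz + #Fq + #Fd = 3 * k := by
    by_contra hne
    have hlt : ((#Fz + #Fq + #Fd : ℕ) : ℝ) + 1 ≤ 3 * k := by
      exact_mod_cast (by omega : #Fz + #Fq + #Fd + 1 ≤ 3 * k)
    have := mul_le_mul_of_nonneg_right hlt hH0.le
    linarith
  have hSeq : S = k * (k + 1) := by
    by_contra hne
    have hlt : (S : ℝ) + 1 ≤ k * (k + 1) := by
      exact_mod_cast (by omega : S + 1 ≤ k * (k + 1))
    have := mul_le_mul_of_nonneg_left hlt (by positivity : 0 ≤ Lc n k + n)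
    rw [hN] at hprofit'
    push_cast at hprofit'
    linarith
  have hedge : ∀ h ∈ range (k + 1), #{q ∈ Fz | h < q.1} + #{q ∈ Fq | q.1 ≤ h} = k :=
    (sum_eq_sum_iff_of_le hedge_e).mp (hSeq.trans hSconst.symm)
  have hFdeq : Fd = Icc 1 k := eq_of_subset_of_card_le hFd (by simp; omega)
  have hposz : ∀ i ∈ Icc 1 k, 1 ≤ #{q ∈ Fz | q.1 = i} := by
    intro i hi
    have hf := hedge_f i hi
    rw [if_pos (hFdeq ▸ hi)] at hf
    obtain ⟨hi1, hik⟩ := mem_Icc.mp hi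
    have he := hedge (i - 1) (by simp; omega)
    have hq : {q ∈ Fq | q.1 ≤ i - 1} = {q ∈ Fq | q.1 < i} :=
      filter_congr fun q _ => by omega
    have hz : {q ∈ Fz | i - 1 < q.1} = {q ∈ Fz | i < q.1} ∪ {q ∈ Fz | q.1 = i} := by
      rw [← filter_or]
      exact filter_congr fun q _ => by omega
    have := card_union_le {q ∈ Fz | i < q.1} {q ∈ Fz | q.1 = i}
    rw [← hz] at this
    rw [hq] at he
    omega
  have hposq : ∀ i ∈ Icc 1 k, 1 ≤ #{q ∈ Fq | q.1 = i} := by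
    intro i hi
    have hf := hedge_f i hi
    rw [if_pos (hFdeq ▸ hi)] at hf
    have he := hedge i (mem_range.mpr (Nat.lt_succ_of_le (mem_Icc.mp hi).2))
    have hq : {q ∈ Fq | q.1 ≤ i} = {q ∈ Fq | q.1 < i} ∪ {q ∈ Fq | q.1 = i} := by
      rw [← filter_or]
      exact filter_congr fun q _ => by omega
    have := card_union_le {q ∈ Fq | q.1 < i} {q ∈ Fq | q.1 = i}
    rw [← hq] at this
    omega
  exact fun i hi => ⟨card_fiber_eq_one hFz' (by omega) hposz i hi,
    card_fiber_eq_one hFq' (by omega) hposq i hi⟩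
end
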